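/- Let Ω be a finite nonempty set and let s be a strictly proper scoring rule on Ω that is continuous on probabilities. Then for every credence function c ∈ 𝒞 \ 𝒫 there exists a probability function p ∈ 𝒫 such that s(p)(ω) < s(c)(ω) for every ω ∈ Ω. -/

import Mathlib

open scoped ENNReal Classical

noncomputable section

/-- A credence function `p : 𝒫ow(Ω) → ℝ` satisfies the axioms of probability. -/
def IsProb {Ω : Type*} [Fintype Ω] (p : Set Ω → ℝ) : Prop :=
  (∀ A : Set Ω, 0 ≤ p A) ∧ p Set.univ = 1 ∧
    ∀ A B : Set Ω, Disjoint A B → p (A ∪ B) = p A + p B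

/-- Expectation `E_p f = Σ_{ω, p({ω}) ≠ 0} p({ω})·f(ω)`. -/
def expect {Ω : Type*} [Fintype Ω] (p : Set Ω → ℝ) (f : Ω → ℝ≥0∞) : ℝ≥0∞ :=
  ∑ ω ∈ Finset.univ.filter (fun ω => p {ω} ≠ 0), ENNReal.ofReal (p {ω}) * f ω

/-- A scoring rule `s : 𝒞 → [0,∞]^Ω` is strictly proper. -/
def StrictlyProper {Ω : Type*} [Fintype Ω] (s : (Set Ω → ℝ) → Ω → ℝ≥0∞) : Prop :=
  ∀ p c : Set Ω → ℝ, IsProb p → c ≠ p → expect p (s p) < expect p (s c)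

/-- For `v` in the simplex, `p_v` is the probability with `p_v({ω}) = v ω`,
extended additively: `p_v(A) = Σ_{ω ∈ A} v ω`. -/
def probOf {Ω : Type*} [Fintype Ω] (v : Ω → ℝ) : Set Ω → ℝ :=
  fun A => ∑ ω ∈ Finset.univ.filter (· ∈ A), v ω

/-- The scoring rule is continuous on probabilities: `v ↦ s(p_v)` is continuous
on the simplex `T`, with `[0,∞]^Ω` carrying the product topology. -/
def ContinuousOnProbs {Ω : Type*} [Fintype Ω] (s : (Set Ω → ℝ) → Ω → ℝ≥0∞) : Prop :=
  ContinuousOn (fun v : Ω → ℝ => s (probOf v)) (stdSimplex ℝ Ω)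

open Filter Topology

/-- The expectation of `f` under the weights `w`, summed over all points. -/
def weightedSum {Ω : Type*} [Fintype Ω] (w : Ω → ℝ) (f : Ω → ℝ≥0∞) : ℝ≥0∞ :=
  ∑ i, ENNReal.ofReal (w i) * f i

section weightedSum

variable {Ω : Type*} [Fintype Ω]

lemma weightedSum_add (w : Ω → ℝ) (f g : Ω → ℝ≥0∞) :
    weightedSum w (fun i => f i + g i) = weightedSum w f + weightedSum w g := by
  simp only [weightedSum, mul_add, Finset.sum_add_distrib]

lemma weightedSum_mono (w : Ω → ℝ) {f g : Ω → ℝ≥0∞} (h : ∀ i, f i ≤ g i) :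
    weightedSum w f ≤ weightedSum w g :=
  Finset.sum_le_sum fun i _ => mul_le_mul_right (h i) _

lemma weightedSum_const {w : Ω → ℝ} (hw : w ∈ stdSimplex ℝ Ω) (a : ℝ≥0∞) :
    weightedSum w (fun _ => a) = a := by
  rw [weightedSum, ← Finset.sum_mul, ← ENNReal.ofReal_sum_of_nonneg fun i _ => hw.1 i, hw.2,
    ENNReal.ofReal_one, one_mul]

lemma weightedSum_lineMap_single {w : Ω → ℝ} (hw : w ∈ stdSimplex ℝ Ω) (ω : Ω) {t : ℝ}
    (ht₀ : 0 ≤ t) (ht₁ : t ≤ 1) (f : Ω → ℝ≥0∞) :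
    weightedSum (AffineMap.lineMap w (Pi.single ω 1) t) f =
      ENNReal.ofReal (1 - t) * weightedSum w f + ENNReal.ofReal t * f ω := by
  have h : ∀ i, ENNReal.ofReal (AffineMap.lineMap w (Pi.single ω (1 : ℝ)) t i) * f i =
      ENNReal.ofReal (1 - t) * (ENNReal.ofReal (w i) * f i) +
        if i = ω then ENNReal.ofReal t * f i else 0 := by
    intro i
    have hnn : 0 ≤ (1 - t) * w i := mul_nonneg (by linarith) (hw.1 i)
    rw [AffineMap.lineMap_apply_module, ← mul_assoc, ← ENNReal.ofReal_mul (by linarith)]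
    by_cases hi : i = ω
    · subst hi
      simp [ENNReal.ofReal_add hnn ht₀, add_mul]
    · simp [hi]
  simp only [weightedSum, h, Finset.sum_add_distrib, Finset.mul_sum, Finset.sum_ite_eq',
    Finset.mem_univ, if_true]

lemma continuous_weightedSum_left {f : Ω → ℝ≥0∞} (hf : ∀ i, f i ≠ ⊤) :
    Continuous fun w : Ω → ℝ => weightedSum w f :=
  continuous_finsetSum _ fun i _ => ENNReal.continuous_mul_const (hf i) |>.comp
    (ENNReal.continuous_ofReal.comp (continuous_apply i))

lemma tendsto_weightedSum {α : Type*} {l : Filter α} (w : Ω → ℝ) {f : α → Ω → ℝ≥0∞}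
    {g : Ω → ℝ≥0∞} (h : Tendsto f l (𝓝 g)) :
    Tendsto (fun a => weightedSum w (f a)) l (𝓝 (weightedSum w g)) :=
  tendsto_finsetSum _ fun i _ =>
    ENNReal.Tendsto.const_mul (tendsto_pi_nhds.1 h i) (Or.inr ENNReal.ofReal_ne_top)

lemma ne_top_of_weightedSum_lt_top {w : Ω → ℝ} {f : Ω → ℝ≥0∞} (h : weightedSum w f < ⊤) {i : Ω}
    (hi : 0 < w i) : f i ≠ ⊤ := by
  intro hf
  have := ENNReal.sum_lt_top.1 h i (Finset.mem_univ i)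
  simp [hf, ENNReal.mul_top, hi] at this

lemma eventually_lineMap_mem_stdSimplex {p u : Ω → ℝ} (hp : p ∈ stdSimplex ℝ Ω)
    (hu : u ∈ stdSimplex ℝ Ω) :
    ∀ᶠ t : ℝ in 𝓝[>] 0, t ∈ Set.Ioo (0 : ℝ) 1 ∧ AffineMap.lineMap p u t ∈ stdSimplex ℝ Ω := by
  filter_upwards [Ioo_mem_nhdsGT (zero_lt_one (α := ℝ))] with t ht
  exact ⟨ht, (convex_stdSimplex ℝ Ω).lineMap_mem hp hu ⟨ht.1.le, ht.2.le⟩⟩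

lemma tendsto_lineMap_nhdsWithin_stdSimplex {p u : Ω → ℝ} (hp : p ∈ stdSimplex ℝ Ω)
    (hu : u ∈ stdSimplex ℝ Ω) :
    Tendsto (fun t : ℝ => AffineMap.lineMap p u t) (𝓝[>] 0) (𝓝[stdSimplex ℝ Ω] p) := by
  refine tendsto_nhdsWithin_iff.2 ⟨?_, (eventually_lineMap_mem_stdSimplex hp hu).mono
    fun t h => h.2⟩
  have h : Continuous fun t : ℝ => (AffineMap.lineMap p u t : Ω → ℝ) :=
    AffineMap.lineMap_continuous
  simpa using (h.tendsto 0).mono_left nhdsWithin_le_nhds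

variable {r : (Ω → ℝ) → Ω → ℝ≥0∞}

/-- The entropy of a continuous proper scoring rule is upper semicontinuous. -/
lemma upperSemicontinuousOn_entropy [Nonempty Ω] (hr : ContinuousOn r (stdSimplex ℝ Ω))
    (hle : ∀ p ∈ stdSimplex ℝ Ω, ∀ q ∈ stdSimplex ℝ Ω, weightedSum p (r p) ≤ weightedSum p (r q))
    (hfin : ∀ p ∈ stdSimplex ℝ Ω, weightedSum p (r p) < ⊤) :
    UpperSemicontinuousOn (fun p => weightedSum p (r p)) (stdSimplex ℝ Ω) := by
  intro p hp y hy
  let u : Ω → ℝ := fun _ => (Fintype.card Ω : ℝ)⁻¹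
  have hu : u ∈ stdSimplex ℝ Ω := ⟨fun i => by positivity, by simp [u]⟩
  have hev : ∀ᶠ t : ℝ in 𝓝[>] 0, weightedSum p (r (AffineMap.lineMap p u t)) < y :=
    (tendsto_weightedSum p ((hr p hp).tendsto.comp
      (tendsto_lineMap_nhdsWithin_stdSimplex hp hu))).eventually_lt_const hy
  obtain ⟨t, hty, ht, htmem⟩ := (hev.and (eventually_lineMap_mem_stdSimplex hp hu)).exists
  have hne : ∀ i, r (AffineMap.lineMap p u t) i ≠ ⊤ := by
    intro i
    refine ne_top_of_weightedSum_lt_top (hfin _ htmem) ?_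
    have h₁ : 0 ≤ (1 - t) * p i := mul_nonneg (by linarith [ht.2]) (hp.1 i)
    have h₂ : 0 < t * u i := mul_pos ht.1 (by positivity)
    simpa [AffineMap.lineMap_apply_module] using add_pos_of_nonneg_of_pos h₁ h₂
  filter_upwards [((continuous_weightedSum_left hne).tendsto p |>.mono_left
    nhdsWithin_le_nhds).eventually_lt_const hty, self_mem_nhdsWithin] with q hq hqT
  exact (hle q hqT _ htmem).trans_lt hq

/-- At a point of maximal entropy, the score is bounded by the entropy. -/
lemma exists_forall_le_entropy [Nonempty Ω] (hr : ContinuousOn r (stdSimplex ℝ Ω))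
    (hle : ∀ p ∈ stdSimplex ℝ Ω, ∀ q ∈ stdSimplex ℝ Ω, weightedSum p (r p) ≤ weightedSum p (r q))
    (hfin : ∀ p ∈ stdSimplex ℝ Ω, weightedSum p (r p) < ⊤) :
    ∃ p ∈ stdSimplex ℝ Ω, ∀ ω, r p ω ≤ weightedSum p (r p) := by
  obtain ⟨p, hp, hmax⟩ := (upperSemicontinuousOn_entropy hr hle hfin).exists_isMaxOn
    (Set.Nonempty.of_subtype (s := stdSimplex ℝ Ω)) (isCompact_stdSimplex ℝ Ω)
  refine ⟨p, hp, fun ω => ?_⟩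
  have hω := single_mem_stdSimplex ℝ ω
  refine le_of_tendsto (tendsto_pi_nhds.1 ((hr p hp).tendsto.comp
    (tendsto_lineMap_nhdsWithin_stdSimplex hp hω)) ω) ?_
  filter_upwards [eventually_lineMap_mem_stdSimplex hp hω] with t ht
  obtain ⟨⟨ht₀, ht₁⟩, htmem⟩ := ht
  set q : Ω → ℝ := AffineMap.lineMap p (Pi.single ω 1) t with hq
  set h := weightedSum p (r p) with hh
  have hsum : ENNReal.ofReal (1 - t) * h + ENNReal.ofReal t * h = h := by
    rw [← add_mul, ← ENNReal.ofReal_add (by linarith) ht₀.le]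
    simp
  have key : ENNReal.ofReal (1 - t) * h + ENNReal.ofReal t * r q ω ≤
      ENNReal.ofReal (1 - t) * h + ENNReal.ofReal t * h := by
    rw [hsum]
    refine le_trans ?_ (hmax htmem)
    change _ ≤ weightedSum q (r q)
    conv_rhs => rw [hq, weightedSum_lineMap_single hp ω ht₀.le ht₁.le]
    gcongr
    exact hle p hp q htmem
  have key' := (ENNReal.add_le_add_iff_left
    (ENNReal.mul_ne_top ENNReal.ofReal_ne_top (hfin p hp).ne)).1 key
  exact (ENNReal.mul_le_mul_iff_right (by simpa using ht₀) ENNReal.ofReal_ne_top).1 key'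

/-- A score that is worse in expectation than the entropy everywhere is dominated. -/
lemma exists_forall_lt_of_entropy_lt [Nonempty Ω] (hr : ContinuousOn r (stdSimplex ℝ Ω))
    (hle : ∀ p ∈ stdSimplex ℝ Ω, ∀ q ∈ stdSimplex ℝ Ω, weightedSum p (r p) ≤ weightedSum p (r q))
    {b : Ω → ℝ≥0∞} (hb : ∀ p ∈ stdSimplex ℝ Ω, weightedSum p (r p) < weightedSum p b) :
    ∃ p ∈ stdSimplex ℝ Ω, ∀ ω, r p ω < b ω := by
  have hfin : ∀ p ∈ stdSimplex ℝ Ω, weightedSum p (r p) < ⊤ := fun p hp => (hb p hp).trans_le le_top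
  have hsub : ∀ (M : ℕ) p, p ∈ stdSimplex ℝ Ω →
      weightedSum p (fun i => (M : ℝ≥0∞) - b i) ≠ ⊤ := fun M p hp =>
    ((weightedSum_mono p fun i => tsub_le_self).trans_lt
      ((weightedSum_const hp (M : ℝ≥0∞)).trans_lt (ENNReal.natCast_lt_top M))).ne
  have hr' : ∀ M : ℕ, ContinuousOn (fun p i => r p i + ((M : ℝ≥0∞) - b i)) (stdSimplex ℝ Ω) :=
    fun M => continuousOn_pi.2 fun i => (continuousOn_pi.1 hr i).add continuousOn_const
  have hle' : ∀ M : ℕ, ∀ p ∈ stdSimplex ℝ Ω, ∀ q ∈ stdSimplex ℝ Ω,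
      weightedSum p (fun i => r p i + ((M : ℝ≥0∞) - b i)) ≤
        weightedSum p (fun i => r q i + ((M : ℝ≥0∞) - b i)) := by
    intro M p hp q hq
    rw [weightedSum_add, weightedSum_add]
    exact add_le_add_left (hle p hp q hq) _
  have hfin' : ∀ M : ℕ, ∀ p ∈ stdSimplex ℝ Ω,
      weightedSum p (fun i => r p i + ((M : ℝ≥0∞) - b i)) < ⊤ := by
    intro M p hp
    rw [weightedSum_add]
    exact ENNReal.add_lt_top.2 ⟨hfin p hp, (hsub M p hp).lt_top⟩
  have hmono : ∀ {M N : ℕ} {p}, p ∈ stdSimplex ℝ Ω → M ≤ N →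
      weightedSum p (fun i => r p i + ((M : ℝ≥0∞) - b i)) < M →
      weightedSum p (fun i => r p i + ((N : ℝ≥0∞) - b i)) < N := by
    intro M N p hp hMN h
    obtain ⟨d, rfl⟩ := Nat.exists_eq_add_of_le hMN
    calc weightedSum p (fun i => r p i + (((M + d : ℕ) : ℝ≥0∞) - b i))
        ≤ weightedSum p (fun i => (r p i + ((M : ℝ≥0∞) - b i)) + d) := by
          refine weightedSum_mono p fun i => ?_
          rw [add_assoc, Nat.cast_add]
          gcongr
          exact add_tsub_le_tsub_add
      _ = weightedSum p (fun i => r p i + ((M : ℝ≥0∞) - b i)) + d := by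
          rw [weightedSum_add, weightedSum_const hp]
      _ < M + d := ENNReal.add_lt_add_right (ENNReal.natCast_ne_top d) h
      _ = ((M + d : ℕ) : ℝ≥0∞) := by push_cast; rfl
  obtain ⟨M, hM⟩ : ∃ M : ℕ, ∀ p ∈ stdSimplex ℝ Ω, p ∈ stdSimplex ℝ Ω →
      weightedSum p (fun i => r p i + ((M : ℝ≥0∞) - b i)) < M := by
    refine (isCompact_stdSimplex ℝ Ω).induction_on
      (p := fun S => ∃ M : ℕ, ∀ p ∈ S, p ∈ stdSimplex ℝ Ω →
        weightedSum p (fun i => r p i + ((M : ℝ≥0∞) - b i)) < M) ⟨0, by simp⟩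
      (fun S T hST ⟨M, hM⟩ => ⟨M, fun p hp => hM p (hST hp)⟩) ?_ ?_
    · rintro S T ⟨M, hM⟩ ⟨N, hN⟩
      refine ⟨max M N, ?_⟩
      rintro p (hp | hp) hpT
      · exact hmono hpT (le_max_left M N) (hM p hp hpT)
      · exact hmono hpT (le_max_right M N) (hN p hp hpT)
    · intro p hp
      have hlim : Tendsto (fun n : ℕ => weightedSum p (fun i => min (b i) (n : ℝ≥0∞))) atTop
          (𝓝 (weightedSum p b)) := by
        refine tendsto_weightedSum p (tendsto_pi_nhds.2 fun i => ?_)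
        simpa using (tendsto_const_nhds (x := b i)).min ENNReal.tendsto_nat_nhds_top
      obtain ⟨M, hM⟩ := (hlim.eventually_const_lt (hb p hp)).exists
      have hlt : weightedSum p (fun i => r p i + ((M : ℝ≥0∞) - b i)) < M := by
        rw [weightedSum_add]
        refine (ENNReal.add_lt_add_right (hsub M p hp) hM).trans_eq ?_
        rw [← weightedSum_add, ← weightedSum_const hp (M : ℝ≥0∞)]
        congr 1
        funext i
        rw [weightedSum_const hp]
        rcases le_total (b i) M with h | h
        · rw [min_eq_left h, add_tsub_cancel_of_le h]
        · rw [min_eq_right h, tsub_eq_zero_of_le h, add_zero]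
      exact ⟨_, upperSemicontinuousOn_entropy (hr' M) (hle' M) (hfin' M) p hp _ hlt |>.and
        self_mem_nhdsWithin, M, fun q hq _ => hq.1⟩
  obtain ⟨p, hp, h⟩ := exists_forall_le_entropy (hr' M) (hle' M) (hfin' M)
  refine ⟨p, hp, fun ω => lt_of_not_ge fun hω => ?_⟩
  refine ((h ω).trans_lt (hM p hp hp)).not_ge ?_
  exact le_add_tsub.trans (add_le_add_left hω _)

end weightedSum

lemma probOf_singleton {Ω : Type*} [Fintype Ω] (v : Ω → ℝ) (ω : Ω) : probOf v {ω} = v ω := by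
  simp only [probOf, Set.mem_singleton_iff, Finset.sum_filter, Finset.sum_ite_eq',
    Finset.mem_univ, if_true]

lemma isProb_probOf {Ω : Type*} [Fintype Ω] {v : Ω → ℝ} (hv : v ∈ stdSimplex ℝ Ω) :
    IsProb (probOf v) := by
  refine ⟨fun A => Finset.sum_nonneg fun i _ => hv.1 i, by simpa [probOf] using hv.2,
    fun A B hAB => ?_⟩
  simp only [probOf, Set.mem_union, Finset.filter_or]
  exact Finset.sum_union (Finset.disjoint_filter.2 fun i _ hA hB => Set.disjoint_left.1 hAB hA hB)

lemma expect_probOf {Ω : Type*} [Fintype Ω] (v : Ω → ℝ) (f : Ω → ℝ≥0∞) :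
    expect (probOf v) f = weightedSum v f := by
  simp only [expect, weightedSum, probOf_singleton]
  refine Finset.sum_filter_of_ne fun i _ h hv => h ?_
  simp [hv]

theorem stmt1 {Ω : Type*} [Fintype Ω] [Nonempty Ω]
    (s : (Set Ω → ℝ) → Ω → ℝ≥0∞) (hs : StrictlyProper s)
    (hcont : ContinuousOnProbs s) :
    ∀ c : Set Ω → ℝ, ¬ IsProb c →
      ∃ p : Set Ω → ℝ, IsProb p ∧ ∀ ω, s p ω < s c ω := by
  intro c hc
  have hle : ∀ p ∈ stdSimplex ℝ Ω, ∀ q ∈ stdSimplex ℝ Ω,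
      weightedSum p (s (probOf p)) ≤ weightedSum p (s (probOf q)) := by
    intro p hp q _
    rw [← expect_probOf, ← expect_probOf]
    rcases eq_or_ne (probOf q) (probOf p) with h | h
    · rw [h]
    · exact (hs _ _ (isProb_probOf hp) h).le
  have hlt : ∀ p ∈ stdSimplex ℝ Ω, weightedSum p (s (probOf p)) < weightedSum p (s c) := by
    intro p hp
    rw [← expect_probOf, ← expect_probOf]
    exact hs _ _ (isProb_probOf hp) fun h => hc (h ▸ isProb_probOf hp)
  obtain ⟨v, hv, h⟩ := exists_forall_lt_of_entropy_lt hcont hle hlt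
  exact ⟨probOf v, isProb_probOf hv, h⟩
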